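/- arXiv:2604.14212 — 8 statements merged into one kernel-verified Lean document; each statement's English description precedes it below -/
import Mathlib

section
/- Let n ∈ ℕ, let a_0, …, a_n ∈ ℂ, let A ∈ ℂ, let c ∈ ℂ with c ≠ 0, let σ ∈ ℂ with σ ≠ 0, and let N ≥ 1 be such that the polynomial (X − σ)^N divides the polynomial (Σ_{j=0}^{n} a_j X^j) − A in ℂ[X]. Then for every natural number m with m ≤ N − 1 and every c-periodic function π : ℂ → ℂ, the function f(z) = z^m * Complex.exp((z/c) * Complex.log σ) * π(z) satisfies Σ_{j=0}^{n} a_j * f(z + j*c) = A * f(z) for all z ∈ ℂ. -/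
open Polynomial in
theorem aux_sum (n : ℕ) (z c σ : ℂ) (m : ℕ) : ∀ (N : ℕ) (b : ℕ → ℂ), m < N →
    (X - C σ) ^ N ∣ (∑ j ∈ Finset.range (n + 1), C (b j) * X ^ j) →
    ∑ j ∈ Finset.range (n + 1), b j * ((z + (j : ℂ) * c) ^ m * σ ^ j) = 0 := by
  induction m with
  | zero =>
    intro N b hN h
    have h1 : (X - C σ) ∣ (∑ j ∈ Finset.range (n + 1), C (b j) * X ^ j) :=
      (dvd_pow_self _ (by omega)).trans h
    rw [dvd_iff_isRoot, IsRoot.def, eval_finsetSum] at h1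
    simpa using h1
  | succ m ih =>
    intro N b hN h
    obtain ⟨M, rfl⟩ : ∃ M, N = M + 1 := ⟨N - 1, by omega⟩
    have key := ih M (fun j => b j * (z + j * c)) (by omega) ?_
    · rw [← key]
      refine Finset.sum_congr rfl fun j _ => ?_
      ring
    · have e : (∑ j ∈ Finset.range (n + 1), C (b j * (z + j * c)) * X ^ j : ℂ[X])
          = C z * (∑ j ∈ Finset.range (n + 1), C (b j) * X ^ j)
            + C c * X * derivative (∑ j ∈ Finset.range (n + 1), C (b j) * X ^ j) := by
        rw [derivative_sum, Finset.mul_sum, Finset.mul_sum, ← Finset.sum_add_distrib]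
        refine Finset.sum_congr rfl fun j _ => ?_
        rcases j with _ | j
        · simp only [Nat.cast_zero, zero_mul, add_zero, pow_zero, mul_one, derivative_C, mul_zero, map_mul]
          ring
        · simp only [derivative_C_mul, derivative_X_pow, map_mul, map_add, map_natCast,
            Nat.add_sub_cancel]
          ring
      rw [e]
      refine dvd_add (((pow_dvd_pow _ (Nat.le_succ M)).trans h).mul_left _) ?_
      refine Dvd.dvd.mul_left ?_ _
      obtain ⟨q, hq⟩ := h
      rw [hq, derivative_mul, derivative_X_sub_C_pow]
      refine dvd_add ?_ ?_
      · simp only [Nat.add_sub_cancel]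
        exact (Dvd.intro_left _ rfl).mul_right _
      · exact (pow_dvd_pow _ (Nat.le_succ M)).mul_right _

theorem stmt_5 (n : ℕ) (a : ℕ → ℂ) (A c σ : ℂ) (hc : c ≠ 0) (hσ : σ ≠ 0)
    (N : ℕ) (hN : 1 ≤ N)
    (hdvd : (Polynomial.X - Polynomial.C σ) ^ N ∣
      (∑ j ∈ Finset.range (n + 1), Polynomial.C (a j) * Polynomial.X ^ j) - Polynomial.C A) :
    ∀ m : ℕ, m ≤ N - 1 → ∀ π : ℂ → ℂ, (∀ z : ℂ, π (z + c) = π z) →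
      ∀ z : ℂ,
        ∑ j ∈ Finset.range (n + 1),
          a j * ((z + (j : ℂ) * c) ^ m *
            Complex.exp (((z + (j : ℂ) * c) / c) * Complex.log σ) * π (z + (j : ℂ) * c))
        = A * (z ^ m * Complex.exp ((z / c) * Complex.log σ) * π z) := by
  intro m hm π hπ z
  have hp : ∀ j : ℕ, π (z + (j : ℂ) * c) = π z := by
    intro j
    induction j with
    | zero => simp
    | succ j ih =>
      rw [← ih, ← hπ (z + j * c)]
      congr 1
      push_cast
      ring
  have he : ∀ j : ℕ, Complex.exp (((z + (j : ℂ) * c) / c) * Complex.log σ)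
      = σ ^ j * Complex.exp ((z / c) * Complex.log σ) := by
    intro j
    have : ((z + (j : ℂ) * c) / c) * Complex.log σ
        = j * Complex.log σ + (z / c) * Complex.log σ := by
      field_simp
      ring
    rw [this, Complex.exp_add, Complex.exp_nat_mul, Complex.exp_log hσ]
  have key := aux_sum n z c σ m N (fun j => a j - if j = 0 then A else 0) (by omega) (by
    convert hdvd using 1
    simp only [map_sub, sub_mul, Finset.sum_sub_distrib]
    congr 1
    rw [Finset.sum_eq_single 0] <;> simp +contextual)
  simp only [sub_mul, Finset.sum_sub_distrib] at key
  rw [Finset.sum_eq_single 0 (f := fun j : ℕ => (if j = 0 then A else 0) * _)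
    (by simp +contextual) (by simp)] at key
  simp only [if_true, Nat.cast_zero, zero_mul, add_zero, pow_zero, mul_one] at key
  rw [sub_eq_zero] at key
  calc _ = (∑ j ∈ Finset.range (n + 1), a j * ((z + (j : ℂ) * c) ^ m * σ ^ j))
        * (Complex.exp ((z / c) * Complex.log σ) * π z) := by
        rw [Finset.sum_mul]
        refine Finset.sum_congr rfl fun j _ => ?_
        rw [hp, he]
        ring
    _ = _ := by
        rw [key]
        ring
end

section
/- Let c ∈ ℂ with c ≠ 0, let ρ_1, …, ρ_n ∈ ℂ be pairwise distinct nonzero numbers, and let π_1, …, π_n : ℂ → ℂ be c-periodic functions. If Σ_{k=1}^{n} Complex.exp((z/c) * Complex.log ρ_k) * π_k(z) = 0 for all z ∈ ℂ, then π_k = 0 for every k = 1, …, n. (The functions ρ_k^(z/c) for distinct ρ_k are linearly independent over the field of c-periodic functions, so the representation of solutions in Class I is unique.) -/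
theorem stmt_6 (n : ℕ) (c : ℂ) (hc : c ≠ 0)
    (ρ : Fin n → ℂ) (hρ : ∀ k, ρ k ≠ 0) (hdist : Function.Injective ρ)
    (π : Fin n → ℂ → ℂ) (hπ : ∀ k, ∀ z : ℂ, π k (z + c) = π k z)
    (hsum : ∀ z : ℂ, ∑ k : Fin n, Complex.exp ((z / c) * Complex.log (ρ k)) * π k z = 0) :
    ∀ k, π k = 0 := by
  have hper : ∀ k, ∀ z : ℂ, ∀ m : ℕ, π k (z + m * c) = π k z := by
    intro k z m
    induction m with
    | zero => simp
    | succ m ih =>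
      rw [← ih, ← hπ k (z + m * c)]
      congr 1
      push_cast
      ring
  intro k
  funext z
  have hv : (fun j => Complex.exp ((z / c) * Complex.log (ρ j)) * π j z) = 0 := by
    apply Matrix.eq_zero_of_forall_pow_sum_mul_pow_eq_zero hdist
    intro i
    rw [← hsum (z + (i : ℕ) * c)]
    apply Finset.sum_congr rfl
    intro j _
    have h1 : (z + (i : ℕ) * c) / c * Complex.log (ρ j)
        = z / c * Complex.log (ρ j) + (i : ℕ) * Complex.log (ρ j) := by
      field_simp
    rw [hper, h1, Complex.exp_add, Complex.exp_nat_mul, Complex.exp_log (hρ j)]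
    ring
  have := congrFun hv k
  simpa [Complex.exp_ne_zero] using this
end

section
/- Let n ≥ 1, let a_0, …, a_n ∈ ℂ with a_n ≠ 0, let A ∈ ℂ, let c ∈ ℂ with c ≠ 0, and suppose ρ_1, …, ρ_n ∈ ℂ are pairwise distinct nonzero numbers each satisfying Σ_{j=0}^{n} a_j * ρ_k^j = A (so that ρ_1, …, ρ_n are precisely the n distinct roots of the characteristic equation). If f : ℂ → ℂ satisfies Σ_{j=0}^{n} a_j * f(z + j*c) = A * f(z) for all z ∈ ℂ, then there exist c-periodic functions π_1, …, π_n : ℂ → ℂ such that f(z) = Σ_{k=1}^{n} Complex.exp((z/c) * Complex.log ρ_k) * π_k(z) for all z ∈ ℂ. -/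
theorem stmt_7 (n : ℕ) (hn : 1 ≤ n) (a : ℕ → ℂ) (han : a n ≠ 0) (A c : ℂ) (hc : c ≠ 0)
    (ρ : Fin n → ℂ) (hρ : ∀ k, ρ k ≠ 0) (hdist : Function.Injective ρ)
    (hroot : ∀ k, ∑ j ∈ Finset.range (n + 1), a j * (ρ k) ^ j = A)
    (f : ℂ → ℂ)
    (hf : ∀ z : ℂ, ∑ j ∈ Finset.range (n + 1), a j * f (z + (j : ℂ) * c) = A * f z) :
    ∃ π : Fin n → ℂ → ℂ, (∀ k, ∀ z : ℂ, π k (z + c) = π k z) ∧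
      ∀ z : ℂ, f z = ∑ k : Fin n, Complex.exp ((z / c) * Complex.log (ρ k)) * π k z := by
  classical
  haveI : Nonempty (Fin n) := ⟨⟨0, hn⟩⟩
  let E : Module.End ℂ (ℂ → ℂ) := LinearMap.funLeft ℂ ℂ (fun z : ℂ => z + c)
  have hE : ∀ (g : ℂ → ℂ) (z : ℂ), E g z = g (z + c) := fun g z => rfl
  have hEp : ∀ (j : ℕ) (g : ℂ → ℂ) (z : ℂ), (E ^ j) g z = g (z + (j : ℂ) * c) := by
    intro j
    induction j with
    | zero => intro g z; simp
    | succ j ih =>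
      intro g z
      rw [pow_succ, Module.End.mul_apply, ih, hE]
      congr 1
      push_cast
      ring
  let P : Polynomial ℂ :=
    ∑ j ∈ Finset.range (n + 1), Polynomial.C (a j) * Polynomial.X ^ j - Polynomial.C A
  let N : Polynomial ℂ := Lagrange.nodal Finset.univ ρ
  have hNdeg : N.natDegree = n := by simp [N, Lagrange.natDegree_nodal]
  have hNmonic : N.Monic := Lagrange.nodal_monic
  have hPN : P = Polynomial.C (a n) * N := by
    rw [← sub_eq_zero]
    apply Polynomial.eq_zero_of_degree_lt_of_eval_index_eq_zero (s := Finset.univ) (v := ρ)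
      hdist.injOn
    · rw [Finset.card_univ, Fintype.card_fin, Polynomial.degree_lt_iff_coeff_zero]
      intro m hm
      have hm0 : m ≠ 0 := by omega
      rcases eq_or_lt_of_le hm with h | h
      · subst h
        have h1 : N.coeff n = 1 := by
          have := hNmonic.coeff_natDegree
          rwa [hNdeg] at this
        simp [P, Polynomial.coeff_C, hm0, h1, Polynomial.coeff_X_pow]
      · have h1 : N.coeff m = 0 := Polynomial.coeff_eq_zero_of_natDegree_lt (by omega)
        simp [P, Polynomial.coeff_C, hm0, h1, Polynomial.coeff_X_pow]
        intro h2; omega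
    · intro i _
      have h1 : N.eval (ρ i) = 0 := Lagrange.eval_nodal_at_node (Finset.mem_univ i)
      simp [P, h1, Polynomial.eval_finset_sum, hroot]
  have hPf : Polynomial.aeval E P f = 0 := by
    funext z
    have := hf z
    simp [P, Module.algebraMap_end_apply, LinearMap.sum_apply, Finset.sum_apply, hEp, this,
      Module.End.mul_apply]
  have hNf : Polynomial.aeval E N f = 0 := by
    rw [hPN, map_mul, Polynomial.aeval_C, Module.End.mul_apply, Module.algebraMap_end_apply] at hPf
    exact (smul_eq_zero.mp hPf).resolve_left han
  let g : Fin n → ℂ → ℂ := fun k => Polynomial.aeval E (Lagrange.basis Finset.univ ρ k) f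
  have hsum : f = ∑ k, g k := by
    have h := Lagrange.sum_basis (s := Finset.univ) (v := ρ) hdist.injOn Finset.univ_nonempty
    have h2 := congrArg (fun p => Polynomial.aeval E p f) h
    simp only [map_sum, LinearMap.sum_apply, map_one, Module.End.one_apply] at h2
    exact h2.symm
  have hg : ∀ k z, g k (z + c) = ρ k * g k z := by
    intro k z
    have hdvd : N ∣ (Polynomial.X - Polynomial.C (ρ k)) * Lagrange.basis Finset.univ ρ k := by
      have e : N = (Polynomial.X - Polynomial.C (ρ k)) *
          ∏ i ∈ Finset.univ.erase k, (Polynomial.X - Polynomial.C (ρ i)) := by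
        simp only [N, Lagrange.nodal]
        exact (Finset.mul_prod_erase _ _ (Finset.mem_univ k)).symm
      rw [e]
      apply mul_dvd_mul_left
      unfold Lagrange.basis Lagrange.basisDivisor
      rw [Finset.prod_mul_distrib]
      exact dvd_mul_left _ _
    obtain ⟨q, hq⟩ := hdvd
    have h : Polynomial.aeval E ((Polynomial.X - Polynomial.C (ρ k)) *
        Lagrange.basis Finset.univ ρ k) f = 0 := by
      rw [hq, mul_comm, map_mul, Module.End.mul_apply, hNf, map_zero]
    rw [map_mul, Module.End.mul_apply] at h
    have h3 := congrFun h z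
    simp only [map_sub, Polynomial.aeval_X, Polynomial.aeval_C, LinearMap.sub_apply,
      Module.algebraMap_end_apply, Pi.sub_apply, Pi.smul_apply, smul_eq_mul, Pi.zero_apply, hE] at h3
    exact sub_eq_zero.mp h3
  refine ⟨fun k z => Complex.exp (-((z / c) * Complex.log (ρ k))) * g k z, ?_, ?_⟩
  · intro k z
    have e : -((z + c) / c * Complex.log (ρ k)) =
        -(z / c * Complex.log (ρ k)) - Complex.log (ρ k) := by
      field_simp
      ring
    simp only []
    rw [hg, e, Complex.exp_sub, Complex.exp_log (hρ k)]
    have := hρ k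
    field_simp
  · intro z
    have h := congrFun hsum z
    rw [Finset.sum_apply] at h
    rw [h]
    refine Finset.sum_congr rfl fun k _ => ?_
    rw [← mul_assoc, ← Complex.exp_add, add_neg_cancel, Complex.exp_zero, one_mul]
end

section
/- Let a_0, a_1, a_2 ∈ ℂ with a_2 ≠ 0 and a_1 ≠ 0, let B ∈ ℂ, and suppose a_1^2 + 4*a_2*B = 4*a_2*a_0 (so that σ := −a_1/(2*a_2) is a nonzero double root of the characteristic quadratic a_2 w^2 + a_1 w + a_0 = B). Let c ∈ ℂ with c ≠ 0. If f : ℂ → ℂ satisfies a_2 * f(z + 2c) + a_1 * f(z + c) + a_0 * f(z) = B * f(z) for all z ∈ ℂ, then there exist c-periodic functions π_0, π_1 : ℂ → ℂ such that f(z) = Complex.exp((z/c) * Complex.log σ) * (π_0(z) + z * π_1(z)) for all z ∈ ℂ. -/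
theorem stmt_9 (a₀ a₁ a₂ : ℂ) (ha₂ : a₂ ≠ 0) (ha₁ : a₁ ≠ 0) (B : ℂ)
    (hdouble : a₁ ^ 2 + 4 * a₂ * B = 4 * a₂ * a₀)
    (c : ℂ) (hc : c ≠ 0)
    (f : ℂ → ℂ)
    (hf : ∀ z : ℂ, a₂ * f (z + 2 * c) + a₁ * f (z + c) + a₀ * f z = B * f z) :
    ∃ π₀ π₁ : ℂ → ℂ, (∀ z : ℂ, π₀ (z + c) = π₀ z) ∧ (∀ z : ℂ, π₁ (z + c) = π₁ z) ∧
      ∀ z : ℂ, f z = Complex.exp ((z / c) * Complex.log (-a₁ / (2 * a₂))) *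
        (π₀ z + z * π₁ z) := by
  obtain ⟨s, hs⟩ : ∃ s, s = -a₁ / (2 * a₂) := ⟨_, rfl⟩
  rw [← hs]
  have hs0 : s ≠ 0 := by
    rw [hs]
    exact div_ne_zero (neg_ne_zero.mpr ha₁) (mul_ne_zero two_ne_zero ha₂)
  have h1 : a₁ = -2 * a₂ * s := by rw [hs]; field_simp
  have h0 : a₀ - B = a₂ * s ^ 2 := by
    have : (4 * a₂) * (a₀ - B) = (4 * a₂) * (a₂ * s ^ 2) := by
      rw [h1] at hdouble
      linear_combination -hdouble
    exact mul_left_cancel₀ (mul_ne_zero (by norm_num) ha₂) this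
  have hrec : ∀ z, f (z + c + c) = 2 * s * f (z + c) - s ^ 2 * f z := by
    intro z
    have h := hf z
    rw [show z + 2 * c = z + c + c by ring, h1] at h
    apply mul_left_cancel₀ ha₂
    linear_combination h - f z * h0
  obtain ⟨E, hE⟩ : ∃ E : ℂ → ℂ, E = fun z => Complex.exp ((z / c) * Complex.log s) := ⟨_, rfl⟩
  have hE0 : ∀ z, E z ≠ 0 := fun z => by rw [hE]; exact Complex.exp_ne_zero _
  have hEc : ∀ z, E (z + c) = s * E z := by
    intro z
    simp only [hE]
    rw [show (z + c) / c * Complex.log s = Complex.log s + z / c * Complex.log s by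
      field_simp; ring, Complex.exp_add, Complex.exp_log hs0]
  have hg : ∀ z, f (z + c + c) / E (z + c + c) = 2 * (f (z + c) / E (z + c)) - f z / E z := by
    intro z
    have := hE0 z
    rw [hrec, hEc, hEc]
    field_simp
  refine ⟨fun z => f z / E z - z * ((f (z + c) / E (z + c) - f z / E z) / c),
    fun z => (f (z + c) / E (z + c) - f z / E z) / c, ?_, ?_, ?_⟩
  · intro z
    simp only [hg]
    generalize f (z + c) / E (z + c) = u
    generalize f z / E z = v
    field_simp
    ring
  · intro z
    simp only [hg]
    ring
  · intro z
    have h := hE0 z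
    have h2 : Complex.exp ((z / c) * Complex.log s) = E z := by rw [hE]
    rw [h2]
    simp only [sub_add_cancel]
    field_simp
end

section
/- Let n ∈ ℕ, let b_0, …, b_n ∈ ℂ with Σ_{j=0}^{n} b_j ≠ 0, and let c ∈ ℂ with c ≠ 0. Let P, Q ∈ ℂ[X] be polynomials with Q ≠ 0, and suppose that for every z ∈ ℂ such that Q(z + j*c) ≠ 0 for all j = 0, …, n, one has Σ_{j=0}^{n} b_j * P(z + j*c) / Q(z + j*c) = 0. Then P = 0. (Hence the homogeneous linear difference equation Σ_{j=0}^n b_j f(z + jc) = 0 with Σ b_j ≠ 0 admits no nonzero rational solution; in particular, any meromorphic solution of L_c^n(f) = A f with A ≠ Σ a_j cannot be a nonzero rational function.) -/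
open Polynomial in
theorem stmt_10 (n : ℕ) (b : ℕ → ℂ) (hb : ∑ j ∈ Finset.range (n + 1), b j ≠ 0)
    (c : ℂ) (hc : c ≠ 0)
    (P Q : Polynomial ℂ) (hQ : Q ≠ 0)
    (heq : ∀ z : ℂ, (∀ j ∈ Finset.range (n + 1), Q.eval (z + (j : ℂ) * c) ≠ 0) →
      ∑ j ∈ Finset.range (n + 1), b j * P.eval (z + (j : ℂ) * c) / Q.eval (z + (j : ℂ) * c) = 0) :
    P = 0 := by
  by_contra hP
  let T : ℕ → ℂ[X] := fun j => taylor ((j : ℂ) * c) Q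
  have hT : ∀ j, T j ≠ 0 := fun j h => hQ ((taylor_eq_zero _ _).1 h)
  let R : ℕ → ℂ[X] := fun j =>
    taylor ((j : ℂ) * c) P * ∏ i ∈ (Finset.range (n + 1)).erase j, T i
  let D : ℂ[X] := ∏ i ∈ Finset.range (n + 1), T i
  have hD : D ≠ 0 := Finset.prod_ne_zero_iff.2 fun i _ => hT i
  let S : ℂ[X] := ∑ j ∈ Finset.range (n + 1), C (b j) * R j
  have hSD : S * D = 0 := by
    apply Polynomial.funext
    intro z
    rw [eval_mul, eval_zero]
    by_cases h : D.eval z = 0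
    · rw [h, mul_zero]
    have hne : ∀ j ∈ Finset.range (n + 1), Q.eval (z + (j : ℂ) * c) ≠ 0 := by
      have h2 := h
      simp only [D, eval_prod, Finset.prod_ne_zero_iff, T, taylor_eval] at h2
      intro j hj
      exact h2 j hj
    have key : S.eval z = D.eval z * ∑ j ∈ Finset.range (n + 1),
        b j * P.eval (z + (j : ℂ) * c) / Q.eval (z + (j : ℂ) * c) := by
      rw [Finset.mul_sum]
      simp only [S, eval_finset_sum]
      refine Finset.sum_congr rfl fun j hj => ?_
      have hDj : D = T j * ∏ i ∈ (Finset.range (n + 1)).erase j, T i :=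
        (Finset.mul_prod_erase _ _ hj).symm
      have hTj : (T j).eval z = Q.eval (z + (j : ℂ) * c) := by
        simp [T, taylor_eval]
      rw [hDj, eval_mul, eval_mul, eval_mul, eval_C, hTj, taylor_eval]
      have := hne j hj
      field_simp
    rw [key, heq z hne, mul_zero, zero_mul]
  have hS : S = 0 := (mul_eq_zero.1 hSD).resolve_right hD
  have hcoef : ∀ j ∈ Finset.range (n + 1),
      (R j).coeff (P.natDegree + n * Q.natDegree) = P.leadingCoeff * Q.leadingCoeff ^ n := by
    intro j hj
    have hdeg : (R j).natDegree = P.natDegree + n * Q.natDegree := by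
      simp only [R]
      rw [natDegree_mul (fun h => hP ((taylor_eq_zero _ _).1 h))
        (Finset.prod_ne_zero_iff.2 fun i _ => hT i), natDegree_prod _ _ fun i _ => hT i]
      simp [T, natDegree_taylor, Finset.card_erase_of_mem hj]
    rw [← hdeg, coeff_natDegree]
    simp only [R]
    rw [leadingCoeff_mul, leadingCoeff_prod]
    simp [T, leadingCoeff_taylor, Finset.card_erase_of_mem hj]
  have h0 : S.coeff (P.natDegree + n * Q.natDegree) = 0 := by rw [hS, coeff_zero]
  simp only [S, finset_sum_coeff, coeff_C_mul] at h0
  rw [Finset.sum_congr rfl fun j hj => by rw [hcoef j hj], ← Finset.sum_mul] at h0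
  have := leadingCoeff_ne_zero.2 hP
  have := leadingCoeff_ne_zero.2 hQ
  simp_all
end

section
/- Let n ≥ 1, let c ∈ ℂ with c ≠ 0, and let f : ℂ → ℂ satisfy Δ_c^n f = 0, where Δ_c^n is the n-fold iterate of the forward difference operator (Δ_c f)(z) = f(z + c) − f(z). Then there exist c-periodic functions π_0, π_1, …, π_{n−1} : ℂ → ℂ such that f(z) = Σ_{m=0}^{n−1} z^m * π_m(z) for all z ∈ ℂ. -/
lemma iter_aux (c : ℂ) (hc : c ≠ 0) (p : ℂ → ℂ) (hp : ∀ z, p (z + c) = p z) (n : ℕ) :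
    ∀ f h : ℂ → ℂ, (fun F : ℂ → ℂ => fun z => F (z + c) - F z)^[n]
      (fun z => f z - p z * h (z / c)) =
      fun z => (fun F : ℂ → ℂ => fun z => F (z + c) - F z)^[n] f z
        - p z * ((fwdDiff (1 : ℂ))^[n] h) (z / c) := by
  induction n with
  | zero => intro f h; rfl
  | succ n ih =>
    intro f h
    simp only [Function.iterate_succ_apply]
    rw [← ih]
    congr 1
    funext z
    have : (z + c) / c = z / c + 1 := by field_simp
    simp only [hp, this, fwdDiff]
    ring

lemma main_aux (c : ℂ) (hc : c ≠ 0) (n : ℕ) : ∀ (f : ℂ → ℂ)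
    (_ : (fun F : ℂ → ℂ => fun z => F (z + c) - F z)^[n] f = 0),
    ∃ π : Fin n → ℂ → ℂ, (∀ m, ∀ z : ℂ, π m (z + c) = π m z) ∧
      ∀ z : ℂ, f z = ∑ m : Fin n, z ^ (m : ℕ) * π m z := by
  induction n with
  | zero =>
    intro f hf
    refine ⟨fun _ _ => 0, fun _ _ => rfl, fun z => ?_⟩
    simpa using congrFun hf z
  | succ n ih =>
    intro f hf
    obtain ⟨p, hpd⟩ : ∃ p, p = (fun F : ℂ → ℂ => fun z => F (z + c) - F z)^[n] f := ⟨_, rfl⟩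
    rw [Function.iterate_succ_apply', ← hpd] at hf
    have hp : ∀ z, p (z + c) = p z := fun z => sub_eq_zero.mp (congrFun hf z)
    have hfac : (n.factorial : ℂ) ≠ 0 := by exact_mod_cast n.factorial_ne_zero
    have key := iter_aux c hc (fun z => p z / n.factorial)
      (fun z => by simp only [hp]) n f (fun x => x ^ n)
    rw [fwdDiff_iter_eq_factorial, ← hpd] at key
    obtain ⟨π, h1, h2⟩ := ih _ (key.trans (by
      funext z
      simp [hfac]))
    refine ⟨Fin.snoc (α := fun _ => ℂ → ℂ) π (fun z => p z / n.factorial / c ^ n), fun m z => ?_, fun z => ?_⟩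
    · refine Fin.lastCases ?_ (fun i => ?_) m
      · simp [hp]
      · simp [h1]
    · rw [Fin.sum_univ_castSucc]
      simp only [Fin.snoc_castSucc, Fin.snoc_last, Fin.val_castSucc, Fin.val_last]
      rw [← h2 z, div_pow]
      ring

theorem stmt_11 (n : ℕ) (hn : 1 ≤ n) (c : ℂ) (hc : c ≠ 0)
    (f : ℂ → ℂ)
    (hf : (fun F : ℂ → ℂ => fun z => F (z + c) - F z)^[n] f = 0) :
    ∃ π : Fin n → ℂ → ℂ, (∀ m, ∀ z : ℂ, π m (z + c) = π m z) ∧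
      ∀ z : ℂ, f z = ∑ m : Fin n, z ^ (m : ℕ) * π m z := by
  exact main_aux c hc n f hf
end

section
/- Let n ≥ 1, let a_0, …, a_n ∈ ℂ with a_n ≠ 0, let A ∈ ℂ, and let c ∈ ℂ with c ≠ 0. Suppose the polynomial (Σ_{j=0}^{n} a_j X^j) − A factors in ℂ[X] as a_n * Π_{k=1}^{q} (X − σ_k)^{N_k}, where σ_1, …, σ_q are pairwise distinct nonzero complex numbers and N_1 + ⋯ + N_q = n. If f : ℂ → ℂ satisfies Σ_{j=0}^{n} a_j * f(z + j*c) = A * f(z) for all z ∈ ℂ, then there exist c-periodic functions π_{k,m} : ℂ → ℂ (for 1 ≤ k ≤ q and 0 ≤ m ≤ N_k − 1) such that f(z) = Σ_{k=1}^{q} Complex.exp((z/c) * Complex.log σ_k) * (Σ_{m=0}^{N_k−1} z^m * π_{k,m}(z)) for all z ∈ ℂ. -/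
/-- The shift operator `f ↦ f (· + c)`. -/
noncomputable def shiftOp (c : ℂ) : Module.End ℂ (ℂ → ℂ) := LinearMap.funLeft ℂ ℂ (fun z => z + c)

theorem shiftOp_apply (c : ℂ) (f : ℂ → ℂ) (z : ℂ) : shiftOp c f z = f (z + c) := rfl

theorem shiftOp_pow_apply (c : ℂ) (k : ℕ) : ∀ (f : ℂ → ℂ) (z : ℂ),
    (shiftOp c ^ k) f z = f (z + (k : ℂ) * c) := by
  induction k with
  | zero => intro f z; simp
  | succ k ih =>
    intro f z
    rw [pow_succ, Module.End.mul_apply, ih, shiftOp_apply]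
    congr 1
    push_cast
    ring

theorem aux_pow_top (c : ℂ) (hc : c ≠ 0) (N : ℕ) (p : ℂ → ℂ) (hp : ∀ z, p (z + c) = p z) (y : ℂ) :
    (fwdDiff c)^[N] (fun z => (z / c) ^ N * p z) y = (N.factorial : ℂ) * p y := by
  have hpk : ∀ k : ℕ, p (y + k • c) = p y := by
    intro k
    induction k with
    | zero => simp
    | succ k ih => rw [succ_nsmul, ← add_assoc, hp, ih]
  have h1 := congrFun (fwdDiff_iter_eq_factorial (R := ℂ) (n := N)) (y / c)
  rw [fwdDiff_iter_eq_sum_shift] at h1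
  rw [fwdDiff_iter_eq_sum_shift]
  have h2 : ((N.factorial : ℂ → ℂ) (y / c)) = (N.factorial : ℂ) := by simp
  rw [h2] at h1
  rw [← h1, Finset.sum_mul]
  refine Finset.sum_congr rfl fun k _ => ?_
  have h3 : (y + k • c) / c = y / c + k • (1 : ℂ) := by
    simp only [nsmul_eq_mul]
    field_simp
  rw [hpk, h3, smul_mul_assoc]

theorem aux_unip (c : ℂ) (hc : c ≠ 0) (N : ℕ) : ∀ (g : ℂ → ℂ), (fwdDiff c)^[N] g = 0 →
    ∃ π : ℕ → ℂ → ℂ, (∀ m z, π m (z + c) = π m z) ∧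
      ∀ z, g z = ∑ m ∈ Finset.range N, z ^ m * π m z := by
  induction N with
  | zero =>
    intro g hg
    refine ⟨fun _ _ => 0, fun _ _ => rfl, fun z => ?_⟩
    simpa using congrFun hg z
  | succ N ih =>
    intro g hg
    have hN : (N.factorial : ℂ) ≠ 0 := by exact_mod_cast N.factorial_ne_zero
    set p : ℂ → ℂ := fun z => (N.factorial : ℂ)⁻¹ * (fwdDiff c)^[N] g z with hpdef
    have hp : ∀ z, p (z + c) = p z := by
      intro z
      rw [Function.iterate_succ_apply'] at hg
      have := congrFun hg z
      simp only [fwdDiff, Pi.zero_apply, sub_eq_zero] at this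
      simp only [hpdef]
      congr 1
    obtain ⟨π, hπ, hg'⟩ := ih (g + (-1 : ℂ) • fun z => (z / c) ^ N * p z) (by
      rw [fwdDiff_iter_add, fwdDiff_iter_const_smul]
      funext y
      simp only [Pi.add_apply, Pi.smul_apply]
      rw [aux_pow_top c hc N p hp]
      simp [hpdef, hN])
    refine ⟨fun m z => if m = N then p z / c ^ N else π m z, ?_, ?_⟩
    · intro m z
      by_cases h : m = N <;> simp [h, hp, hπ]
    · intro z
      rw [Finset.sum_range_succ]
      have h1 : ∑ m ∈ Finset.range N, z ^ m * (if m = N then p z / c ^ N else π m z)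
          = ∑ m ∈ Finset.range N, z ^ m * π m z := by
        refine Finset.sum_congr rfl fun m hm => ?_
        rw [if_neg (Finset.mem_range.1 hm).ne]
      rw [h1, ← hg' z]
      simp only [Pi.add_apply, Pi.smul_apply, smul_eq_mul, if_true, div_pow]
      ring

theorem aux_exp (c : ℂ) (hc : c ≠ 0) (s : ℂ) (hs : s ≠ 0) (z : ℂ) :
    Complex.exp (((z + c) / c) * Complex.log s) = s * Complex.exp ((z / c) * Complex.log s) := by
  have : ((z + c) / c) * Complex.log s = Complex.log s + (z / c) * Complex.log s := by
    field_simp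
    ring
  rw [this, Complex.exp_add, Complex.exp_log hs]

theorem aux_conj (c : ℂ) (hc : c ≠ 0) (s : ℂ) (hs : s ≠ 0) (N : ℕ) : ∀ g : ℂ → ℂ,
    ((shiftOp c - algebraMap ℂ (Module.End ℂ (ℂ → ℂ)) s) ^ N)
      (fun z => Complex.exp ((z / c) * Complex.log s) * g z)
      = fun z => Complex.exp ((z / c) * Complex.log s) * (s ^ N * (fwdDiff c)^[N] g z) := by
  induction N with
  | zero => intro g; simp
  | succ N ih =>
    intro g
    rw [pow_succ', Module.End.mul_apply, ih]
    funext z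
    rw [Function.iterate_succ_apply']
    simp only [LinearMap.sub_apply, Pi.sub_apply, Module.algebraMap_end_apply, Pi.smul_apply,
      smul_eq_mul, shiftOp_apply]
    rw [aux_exp c hc s hs]
    simp only [fwdDiff]
    ring

open Polynomial in
theorem aux_decomp (T : Module.End ℂ (ℂ → ℂ)) {q : ℕ} (p : Fin q → ℂ[X])
    (hp : ∀ i j, i ≠ j → IsCoprime (p i) (p j)) (s : Finset (Fin q)) :
    ∀ f : ℂ → ℂ, aeval T (∏ k ∈ s, p k) f = 0 →
      ∃ F : Fin q → ℂ → ℂ, (∀ k, aeval T (p k) (F k) = 0) ∧ f = ∑ k ∈ s, F k := by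
  induction s using Finset.induction_on with
  | empty =>
    intro f hf
    refine ⟨0, by simp, by simpa using hf⟩
  | insert i s hi ih =>
    intro f hf
    rw [Finset.prod_insert hi] at hf
    have hco : IsCoprime (p i) (∏ k ∈ s, p k) :=
      IsCoprime.prod_right fun j hj => hp i j (fun h => hi (h ▸ hj))
    have hf' : f ∈ LinearMap.ker (aeval T (p i * ∏ k ∈ s, p k)) := hf
    rw [← sup_ker_aeval_eq_ker_aeval_mul_of_coprime T hco] at hf'
    obtain ⟨x, hx, y, hy, hxy⟩ := Submodule.mem_sup.1 hf'
    obtain ⟨F, hF, hyF⟩ := ih y hy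
    refine ⟨Function.update F i x, ?_, ?_⟩
    · intro k
      by_cases h : k = i
      · subst h; simpa using hx
      · simpa [h] using hF k
    · rw [Finset.sum_insert hi, ← hxy, hyF]
      simp only [Function.update_self]
      congr 1
      refine Finset.sum_congr rfl fun k hk => ?_
      rw [Function.update_of_ne (by rintro rfl; exact hi hk)]

theorem stmt_12 (n : ℕ) (hn : 1 ≤ n) (a : ℕ → ℂ) (han : a n ≠ 0) (A c : ℂ) (hc : c ≠ 0)
    (q : ℕ) (σ : Fin q → ℂ) (hσ : ∀ k, σ k ≠ 0) (hdist : Function.Injective σ)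
    (N : Fin q → ℕ) (hNsum : ∑ k : Fin q, N k = n)
    (hfact : (∑ j ∈ Finset.range (n + 1), Polynomial.C (a j) * Polynomial.X ^ j)
        - Polynomial.C A
      = Polynomial.C (a n) * ∏ k : Fin q, (Polynomial.X - Polynomial.C (σ k)) ^ (N k))
    (f : ℂ → ℂ)
    (hf : ∀ z : ℂ, ∑ j ∈ Finset.range (n + 1), a j * f (z + (j : ℂ) * c) = A * f z) :
    ∃ π : Fin q → ℕ → ℂ → ℂ, (∀ k m, ∀ z : ℂ, π k m (z + c) = π k m z) ∧
      ∀ z : ℂ, f z = ∑ k : Fin q, Complex.exp ((z / c) * Complex.log (σ k)) *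
        (∑ m ∈ Finset.range (N k), z ^ m * π k m z) := by
  set T := shiftOp c with hT
  have h0 : Polynomial.aeval T ((∑ j ∈ Finset.range (n + 1),
      Polynomial.C (a j) * Polynomial.X ^ j) - Polynomial.C A) f = 0 := by
    funext z
    have := hf z
    simp [LinearMap.sum_apply, Module.algebraMap_end_apply, hT, shiftOp_pow_apply, this]
  rw [hfact, map_mul, Polynomial.aeval_C, Module.End.mul_apply, Module.algebraMap_end_apply] at h0
  have h1 := (smul_eq_zero.1 h0).resolve_left han
  obtain ⟨F, hF, hfF⟩ := aux_decomp T (fun k => (Polynomial.X - Polynomial.C (σ k)) ^ N k)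
    (fun i j hij => (Polynomial.isCoprime_X_sub_C_of_isUnit_sub
      (sub_ne_zero.2 (hdist.ne hij)).isUnit).pow) Finset.univ f h1
  have h2 : ∀ k, ∃ π : ℕ → ℂ → ℂ, (∀ m z, π m (z + c) = π m z) ∧
      ∀ z, F k z = Complex.exp ((z / c) * Complex.log (σ k)) *
        ∑ m ∈ Finset.range (N k), z ^ m * π m z := by
    intro k
    have hFk := hF k
    set g : ℂ → ℂ := fun z => (Complex.exp ((z / c) * Complex.log (σ k)))⁻¹ * F k z with hg
    have hFg : F k = fun z => Complex.exp ((z / c) * Complex.log (σ k)) * g z := by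
      funext z
      simp [hg, Complex.exp_ne_zero]
    have hgz : (fwdDiff c)^[N k] g = 0 := by
      rw [hFg] at hFk
      simp only [map_pow, map_sub, Polynomial.aeval_X, Polynomial.aeval_C] at hFk
      rw [hT, aux_conj c hc (σ k) (hσ k)] at hFk
      funext z
      have := congrFun hFk z
      simpa [Complex.exp_ne_zero, hσ k] using this
    obtain ⟨π, hπ, hgπ⟩ := aux_unip c hc (N k) g hgz
    refine ⟨π, hπ, fun z => ?_⟩
    rw [← hgπ z, hFg]
  choose π hπ hFπ using h2
  refine ⟨π, hπ, fun z => ?_⟩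
  rw [hfF, Finset.sum_apply]
  exact Finset.sum_congr rfl fun k _ => hFπ k z
end

section
/- Let a, b ∈ ℂ with a ≠ 0 and b ≠ 0, let c ∈ ℂ, let n ∈ ℕ, and let a_0, …, a_n ∈ ℂ satisfy Σ_{j=0}^{n} a_j = 0 and K := Σ_{j=0}^{n} a_j * Complex.exp(j*c) ≠ 0. Define f(z) = b * Complex.exp(z) + a. Then: (i) L_c^n(f)(z) = b * K * Complex.exp(z) for all z ∈ ℂ; (ii) f(z) ≠ a for every z ∈ ℂ; and (iii) there exists z ∈ ℂ with L_c^n(f)(z) = a. Consequently f and L_c^n(f) do not share the value a (the zero set of f − a is empty while the zero set of L_c^n(f) − a is nonempty). -/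
theorem stmt_14 (a b : ℂ) (ha : a ≠ 0) (hb : b ≠ 0) (c : ℂ) (n : ℕ) (coef : ℕ → ℂ)
    (hsum : ∑ j ∈ Finset.range (n + 1), coef j = 0)
    (hK : ∑ j ∈ Finset.range (n + 1), coef j * Complex.exp ((j : ℂ) * c) ≠ 0)
    (f : ℂ → ℂ) (hf : ∀ z : ℂ, f z = b * Complex.exp z + a) :
    (∀ z : ℂ, ∑ j ∈ Finset.range (n + 1), coef j * f (z + (j : ℂ) * c)
        = b * (∑ j ∈ Finset.range (n + 1), coef j * Complex.exp ((j : ℂ) * c)) * Complex.exp z)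
    ∧ (∀ z : ℂ, f z ≠ a)
    ∧ (∃ z : ℂ, ∑ j ∈ Finset.range (n + 1), coef j * f (z + (j : ℂ) * c) = a) := by
  have h1 : ∀ z : ℂ, ∑ j ∈ Finset.range (n + 1), coef j * f (z + (j : ℂ) * c)
        = b * (∑ j ∈ Finset.range (n + 1), coef j * Complex.exp ((j : ℂ) * c))
          * Complex.exp z := by
    intro z
    have h2 : ∀ j ∈ Finset.range (n + 1), coef j * f (z + (j : ℂ) * c)
        = b * Complex.exp z * (coef j * Complex.exp ((j : ℂ) * c)) + coef j * a := by
      intro j _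
      rw [hf, Complex.exp_add]
      ring
    rw [Finset.sum_congr rfl h2, Finset.sum_add_distrib, ← Finset.mul_sum, ← Finset.sum_mul,
      hsum]
    ring
  refine ⟨h1, ?_, ?_⟩
  · intro z hz
    rw [hf] at hz
    exact mul_ne_zero hb (Complex.exp_ne_zero z) (by simpa using hz)
  · have hbK := mul_ne_zero hb hK
    refine ⟨Complex.log (a / (b * ∑ j ∈ Finset.range (n + 1),
      coef j * Complex.exp ((j : ℂ) * c))), ?_⟩
    rw [h1, Complex.exp_log (div_ne_zero ha hbK)]
    exact mul_div_cancel₀ _ hbK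
end
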